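/- (Knabe-type bound in 1D) Let 3 ≤ n ≤ m/2, let h_1,...,h_{m+1} be projections commuting at cyclic distance ≥ 2, and let c_0,...,c_{n-2} be positive reals non-decreasing to the midpoint and symmetric about it. Define B_{n,l} = Σ_{j=l}^{l+n-2} c_{j-l} h_j (indices mod m+1), H = Σ_{i=1}^{m+1} h_i, Q = Σ_i {h_i, h_{i+1}}, F = Σ_{d(i,i')≥2} h_i h_{i'}. Then Σ_{l=1}^{m+1} B_{n,l}² ≤ (Σ_{j=0}^{n-2} c_j²) H + (Σ_{j=0}^{n-3} c_j c_{j+1}) (Q + F) in the Loewner order. -/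

import Mathlib

open ComplexOrder

namespace Knabe

noncomputable def a (n : ℕ) (c : ℕ → ℝ) (r : ℤ) : ℝ :=
  ∑ j ∈ Finset.range (n - 1), ∑ k ∈ Finset.range (n - 1),
    if (k : ℤ) - j = r then c j * c k else 0

noncomputable def C (n : ℕ) (c : ℕ → ℝ) (x : ℤ) : ℝ :=
  ∑ j ∈ Finset.range (n - 1), if (j : ℤ) = x then c j else 0

lemma a_neg (n : ℕ) (c : ℕ → ℝ) (r : ℤ) : a n c (-r) = a n c r := by
  unfold a
  rw [Finset.sum_comm]
  refine Finset.sum_congr rfl fun j _ => Finset.sum_congr rfl fun k _ => ?_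
  rw [mul_comm (c k)]
  refine if_congr ?_ rfl rfl
  constructor <;> intro h <;> omega

lemma C_in (n : ℕ) (c : ℕ → ℝ) (j : ℕ) (hj : j < n - 1) : C n c j = c j := by
  unfold C
  rw [Finset.sum_eq_single j]
  · simp
  · intro b _ hb
    rw [if_neg]
    exact_mod_cast hb
  · intro h; exact absurd (Finset.mem_range.2 hj) h

lemma C_out (n : ℕ) (c : ℕ → ℝ) (x : ℤ) (hx : x < 0 ∨ (n : ℤ) - 1 ≤ x) : C n c x = 0 := by
  unfold C
  refine Finset.sum_eq_zero fun j hj => if_neg ?_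
  have := Finset.mem_range.1 hj
  omega

lemma a_zero (n : ℕ) (c : ℕ → ℝ) : a n c 0 = ∑ j ∈ Finset.range (n - 1), c j ^ 2 := by
  unfold a
  refine Finset.sum_congr rfl fun j hj => ?_
  rw [Finset.sum_eq_single j]
  · simp [sq]
  · intro b _ hb
    rw [if_neg]
    omega
  · intro h; exact absurd hj h

lemma a_one (n : ℕ) (hn : 3 ≤ n) (c : ℕ → ℝ) :
    a n c 1 = ∑ j ∈ Finset.range (n - 2), c j * c (j + 1) := by
  unfold a
  obtain ⟨p, rfl⟩ : ∃ p, n = p + 2 := ⟨n - 2, by omega⟩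
  simp only [Nat.add_sub_cancel, show p + 2 - 1 = p + 1 from rfl]
  rw [Finset.sum_range_succ]
  have h0 : (∑ k ∈ Finset.range (p + 1), if (k : ℤ) - p = 1 then c p * c k else 0) = 0 := by
    refine Finset.sum_eq_zero fun j hj => if_neg ?_
    have := Finset.mem_range.1 hj
    omega
  rw [h0, add_zero]
  refine Finset.sum_congr rfl fun j hj => ?_
  have := Finset.mem_range.1 hj
  rw [Finset.sum_eq_single (j + 1)]
  · simp
  · intro b _ hb
    rw [if_neg]
    omega
  · intro h; exact absurd (Finset.mem_range.2 (by omega)) h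

lemma a_eq (n : ℕ) (c : ℕ → ℝ) (s t : ℤ) (I : Finset ℤ)
    (hI : ∀ x : ℤ, 0 ≤ x + s → x + s < (n : ℤ) - 1 → x ∈ I) :
    ∑ x ∈ I, C n c (x + s) * C n c (x + t) = a n c (t - s) := by
  unfold C a
  simp only [Finset.sum_mul_sum]
  rw [Finset.sum_comm]
  refine Finset.sum_congr rfl fun j hj => ?_
  rw [Finset.sum_comm]
  refine Finset.sum_congr rfl fun k hk => ?_
  have := Finset.mem_range.1 hj
  rw [Finset.sum_eq_single ((j : ℤ) - s)]
  · rw [if_pos (by ring), mul_ite, mul_zero]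
    refine if_congr ?_ rfl rfl
    constructor <;> intro h <;> omega
  · intro b _ hb
    rw [if_neg (by omega), zero_mul]
  · intro h; exact absurd (hI _ (by omega) (by omega)) h

section

lemma c_mono (n : ℕ) (c : ℕ → ℝ) (hmono : ∀ j, 1 ≤ j → 2 * j ≤ n - 2 → c (j - 1) ≤ c j)
    (i j : ℕ) (hij : i ≤ j) (hj : 2 * j ≤ n - 2) : c i ≤ c j := by
  induction j, hij using Nat.le_induction with
  | base => exact le_rfl
  | succ k hk ih =>
    exact (ih (by omega)).trans (hmono (k + 1) (by omega) hj)

lemma c_fold (n : ℕ) (c : ℕ → ℝ) (hsym : ∀ j, 2 * j ≤ n - 2 → c j = c (n - 2 - j))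
    (j : ℕ) (hj : j ≤ n - 2) : c j = c (min j (n - 2 - j)) := by
  rcases le_total j (n - 2 - j) with h | h
  · rw [min_eq_left h]
  · rw [min_eq_right h]
    rw [hsym (n - 2 - j) (by omega)]
    congr 1
    omega

lemma C_mono (n : ℕ) (hn : 3 ≤ n) (c : ℕ → ℝ) (hpos : ∀ j ≤ n - 2, 0 < c j)
    (hmono : ∀ j, 1 ≤ j → 2 * j ≤ n - 2 → c (j - 1) ≤ c j)
    (hsym : ∀ j, 2 * j ≤ n - 2 → c j = c (n - 2 - j)) (x y : ℤ)
    (hxy : |2 * x - (n - 2)| ≤ |2 * y - (n - 2)|) : C n c y ≤ C n c x := by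
  by_cases hy : y < 0 ∨ (n : ℤ) - 1 ≤ y
  · rw [C_out n c y hy]
    unfold C
    refine Finset.sum_nonneg fun j hj => ?_
    have := Finset.mem_range.1 hj
    have := (hpos j (by omega)).le
    split_ifs <;> simp [this]
  · push Not at hy
    have hx : 0 ≤ x ∧ x < n - 1 := by
      rcases abs_cases (2 * x - ((n : ℤ) - 2)) with h | h <;>
      rcases abs_cases (2 * y - ((n : ℤ) - 2)) with h' | h' <;> omega
    obtain ⟨y, rfl⟩ := Int.eq_ofNat_of_zero_le hy.1
    obtain ⟨x, rfl⟩ := Int.eq_ofNat_of_zero_le hx.1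
    rw [C_in n c y (by omega), C_in n c x (by omega), c_fold n c hsym y (by omega),
      c_fold n c hsym x (by omega)]
    apply c_mono n c hmono
    · rcases abs_cases (2 * (x : ℤ) - ((n : ℤ) - 2)) with h | h <;>
      rcases abs_cases (2 * (y : ℤ) - ((n : ℤ) - 2)) with h' | h' <;> omega
    · omega

lemma a_le (n : ℕ) (hn : 3 ≤ n) (c : ℕ → ℝ) (hpos : ∀ j ≤ n - 2, 0 < c j)
    (hmono : ∀ j, 1 ≤ j → 2 * j ≤ n - 2 → c (j - 1) ≤ c j)
    (hsym : ∀ j, 2 * j ≤ n - 2 → c j = c (n - 2 - j)) (r : ℤ) (hr : 1 ≤ r) :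
    a n c r ≤ a n c 1 := by
  have key : 0 ≤ ∑ x ∈ Finset.Icc (-1 - r) (n : ℤ),
      (C n c (x + 0) - C n c (x + (r + 1))) * (C n c (x + 1) - C n c (x + r)) := by
    refine Finset.sum_nonneg fun x _ => ?_
    rcases le_total (2 * x + r + 1) ((n : ℤ) - 2) with h | h
    · refine mul_nonneg_of_nonpos_of_nonpos (sub_nonpos.2 ?_) (sub_nonpos.2 ?_) <;>
      · apply C_mono n hn c hpos hmono hsym
        rcases abs_cases (2 * (x + 0) - ((n : ℤ) - 2)) with h1 | h1 <;>
        rcases abs_cases (2 * (x + 1) - ((n : ℤ) - 2)) with h2 | h2 <;>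
        rcases abs_cases (2 * (x + r) - ((n : ℤ) - 2)) with h3 | h3 <;>
        rcases abs_cases (2 * (x + (r + 1)) - ((n : ℤ) - 2)) with h4 | h4 <;> omega
    · refine mul_nonneg (sub_nonneg.2 ?_) (sub_nonneg.2 ?_) <;>
      · apply C_mono n hn c hpos hmono hsym
        rcases abs_cases (2 * (x + 0) - ((n : ℤ) - 2)) with h1 | h1 <;>
        rcases abs_cases (2 * (x + 1) - ((n : ℤ) - 2)) with h2 | h2 <;>
        rcases abs_cases (2 * (x + r) - ((n : ℤ) - 2)) with h3 | h3 <;>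
        rcases abs_cases (2 * (x + (r + 1)) - ((n : ℤ) - 2)) with h4 | h4 <;> omega
  have e : ∑ x ∈ Finset.Icc (-1 - r) (n : ℤ),
      (C n c (x + 0) - C n c (x + (r + 1))) * (C n c (x + 1) - C n c (x + r)) =
      a n c (1 - 0) - a n c (r - 0) - a n c (1 - (r + 1)) + a n c (r - (r + 1)) := by
    rw [← a_eq n c 0 1 (Finset.Icc (-1 - r) (n : ℤ)), ← a_eq n c 0 r (Finset.Icc (-1 - r) (n : ℤ)),
      ← a_eq n c (r + 1) 1 (Finset.Icc (-1 - r) (n : ℤ)),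
      ← a_eq n c (r + 1) r (Finset.Icc (-1 - r) (n : ℤ)),
      ← Finset.sum_sub_distrib, ← Finset.sum_sub_distrib, ← Finset.sum_add_distrib]
    · exact Finset.sum_congr rfl fun x _ => by ring
    all_goals intro x h1 h2; rw [Finset.mem_Icc]; omega
  rw [e, show (1 : ℤ) - (r + 1) = -r by ring, show r - (r + 1) = -1 by ring, a_neg, a_neg,
    sub_zero, sub_zero] at key
  linarith

lemma a_le' (n : ℕ) (hn : 3 ≤ n) (c : ℕ → ℝ) (hpos : ∀ j ≤ n - 2, 0 < c j)
    (hmono : ∀ j, 1 ≤ j → 2 * j ≤ n - 2 → c (j - 1) ≤ c j)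
    (hsym : ∀ j, 2 * j ≤ n - 2 → c j = c (n - 2 - j)) (r : ℤ) (hr : r ≠ 0) :
    a n c r ≤ a n c 1 := by
  rcases lt_or_gt_of_ne hr with h | h
  · rw [← a_neg]; exact a_le n hn c hpos hmono hsym _ (by omega)
  · exact a_le n hn c hpos hmono hsym _ (by omega)
end

/-- autocorrelation on the cycle -/
noncomputable def A (m n : ℕ) (c : ℕ → ℝ) (x : ZMod (m + 1)) : ℝ :=
  ∑ j ∈ Finset.range (n - 1), ∑ k ∈ Finset.range (n - 1),
    if (k : ZMod (m + 1)) - j = x then c j * c k else 0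

lemma A_eq (m n : ℕ) (hn : 3 ≤ n) (hnm : 2 * n ≤ m) (c : ℕ → ℝ) (r : ℤ)
    (hr : |r| * 2 ≤ m + 1) : A m n c (r : ZMod (m + 1)) = a n c r := by
  unfold A a
  refine Finset.sum_congr rfl fun j hj => Finset.sum_congr rfl fun k hk => ?_
  have := Finset.mem_range.1 hj
  have := Finset.mem_range.1 hk
  refine if_congr ?_ rfl rfl
  constructor
  · intro h
    have h1 : (((k : ℤ) - j - r : ℤ) : ZMod (m + 1)) = 0 := by
      push_cast; rw [h]; simp
    rw [ZMod.intCast_zmod_eq_zero_iff_dvd] at h1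
    have h2 := Int.eq_zero_of_abs_lt_dvd h1 (by
      rw [abs_lt]
      rcases abs_cases r with h | h <;> push_cast <;> omega)
    omega
  · intro h; rw [← h]; push_cast; rfl

lemma psd_mul {N : ℕ} (P R : Matrix (Fin N) (Fin N) ℂ) (hP : P.IsHermitian) (hR : R.IsHermitian)
    (hP2 : P * P = P) (hR2 : R * R = R) (hc : Commute P R) : (P * R).PosSemidef := by
  have : P * R = (P * R).conjTranspose * (P * R) := by
    rw [Matrix.conjTranspose_mul, hP.eq, hR.eq]
    calc P * R = R * P := hc
      _ = (R * P) * P := by rw [mul_assoc, hP2]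
      _ = (P * R) * P := by rw [hc.eq]
      _ = P * (P * R) := by rw [mul_assoc, hc.eq]
      _ = P * P * (R * R) := by rw [hP2, hR2, ← mul_assoc, hP2]
      _ = P * (P * R) * R := by simp only [mul_assoc]
      _ = P * (R * P) * R := by rw [hc.eq]
      _ = (P * R) * (P * R) := by simp only [mul_assoc]
      _ = R * P * (P * R) := by rw [hc.eq]
  rw [this]
  exact Matrix.posSemidef_conjTranspose_mul_self _

end Knabe

open Knabe in
/-- Knabe-type bound in 1D: with `B_{n,l} = ∑_{j=0}^{n-2} c_j h_{l+j}`,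
`∑_l B_{n,l}² ≤ (∑ c_j²) H + (∑ c_j c_{j+1})(Q + F)` in the Loewner order. -/
theorem stmt_12 (m N n : ℕ) (hm : 6 ≤ m) (hn : 3 ≤ n) (hnm : 2 * n ≤ m)
    (h : ZMod (m + 1) → Matrix (Fin N) (Fin N) ℂ)
    (hherm : ∀ i, (h i).IsHermitian) (hidem : ∀ i, h i * h i = h i)
    (hcomm : ∀ i i', i' ≠ i → i' ≠ i + 1 → i' ≠ i - 1 → Commute (h i) (h i'))
    (c : ℕ → ℝ) (hpos : ∀ j ≤ n - 2, 0 < c j)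
    (hmono : ∀ j, 1 ≤ j → 2 * j ≤ n - 2 → c (j - 1) ≤ c j)
    (hsym : ∀ j, 2 * j ≤ n - 2 → c j = c (n - 2 - j)) :
    let H := ∑ i, h i
    let Q := ∑ i, (h i * h (i + 1) + h (i + 1) * h i)
    let F := ∑ i, ∑ i' ∈ Finset.univ.filter (fun i' => i' ≠ i ∧ i' ≠ i + 1 ∧ i' ≠ i - 1),
      h i * h i'
    let B := fun l : ZMod (m + 1) => ∑ j ∈ Finset.range (n - 1), c j • h (l + (j : ZMod (m + 1)))
    ((∑ j ∈ Finset.range (n - 1), c j ^ 2) • H +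
        (∑ j ∈ Finset.range (n - 2), c j * c (j + 1)) • (Q + F) -
        ∑ l, B l * B l).PosSemidef := by
  intro H Q F B
  set S : ZMod (m + 1) → Matrix (Fin N) (Fin N) ℂ := fun x => ∑ i, h i * h (i + x) with hS
  set T : Finset (ZMod (m + 1)) := Finset.univ.filter (fun x => x ≠ 0 ∧ x ≠ 1 ∧ x ≠ -1) with hT
  have hH : H = S 0 := by simp [H, hS, hidem]
  have hQ : Q = S 1 + S (-1) := by
    simp only [Q, hS, Finset.sum_add_distrib]
    congr 1
    refine Fintype.sum_equiv (Equiv.addRight 1) _ _ fun i => ?_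
    simp
  have hF : F = ∑ x ∈ T, S x := by
    simp only [F, hS]
    rw [Finset.sum_comm (s := T)]
    refine Finset.sum_congr rfl fun i _ => ?_
    refine Finset.sum_bij' (fun x _ => x - i) (fun x _ => i + x) ?_ ?_ ?_ ?_ ?_
    · intro x hx
      simp only [hT, Finset.mem_filter, Finset.mem_univ, true_and] at hx ⊢
      refine ⟨fun e => hx.1 ?_, fun e => hx.2.1 ?_, fun e => hx.2.2 ?_⟩ <;>
        rw [sub_eq_iff_eq_add] at e <;> rw [e] <;> ring
    · intro x hx
      simp only [hT, Finset.mem_filter, Finset.mem_univ, true_and] at hx ⊢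
      refine ⟨fun e => hx.1 ?_, fun e => hx.2.1 ?_, fun e => hx.2.2 ?_⟩ <;>
        apply add_left_cancel (a := i) <;> rw [e] <;> ring
    · intro x _; ring
    · intro x _; ring
    · intro x _; simp
  have hB : ∑ l, B l * B l = ∑ x, A m n c x • S x := by
    have h1 : ∀ l, B l * B l = ∑ j ∈ Finset.range (n - 1), ∑ k ∈ Finset.range (n - 1),
        (c j * c k) • (h (l + j) * h (l + k)) := by
      intro l
      simp only [B, Finset.sum_mul_sum, smul_mul_smul_comm]
    simp only [h1, A, Finset.sum_smul]
    rw [Finset.sum_comm]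
    conv_rhs => rw [Finset.sum_comm]
    refine Finset.sum_congr rfl fun j _ => ?_
    rw [Finset.sum_comm]
    conv_rhs => rw [Finset.sum_comm]
    refine Finset.sum_congr rfl fun k _ => ?_
    simp only [ite_smul, zero_smul, Finset.sum_ite_eq, Finset.mem_univ, if_true]
    rw [← Finset.smul_sum]
    congr 1
    refine Fintype.sum_equiv (Equiv.addRight (j : ZMod (m + 1))) _ _ fun i => ?_
    simp only [Equiv.coe_addRight]
    congr 2
    ring
  have hA0 : A m n c 0 = a n c 0 := by
    simpa using A_eq m n hn hnm c 0 (by simp; omega)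
  have hA1 : A m n c 1 = a n c 1 := by
    simpa using A_eq m n hn hnm c 1 (by simp; omega)
  have hA2 : A m n c (-1) = a n c 1 := by
    rw [← a_neg]
    simpa using A_eq m n hn hnm c (-1) (by simp; omega)
  have hne : ∀ z : ℤ, z ≠ 0 → |z| < m + 1 → (z : ZMod (m + 1)) ≠ 0 := by
    intro z hz hz2 h1
    rw [ZMod.intCast_zmod_eq_zero_iff_dvd] at h1
    exact hz (Int.eq_zero_of_abs_lt_dvd h1 (by push_cast; exact hz2))
  have n1 : (1 : ZMod (m + 1)) ≠ 0 := by simpa using hne 1 (by simp) (by simp; omega)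
  have n2 : (1 : ZMod (m + 1)) ≠ -1 := by
    intro e
    refine hne 2 (by simp) (by rw [abs_of_pos] <;> omega) ?_
    have : (1 : ZMod (m + 1)) + 1 = 0 := by nth_rewrite 1 [e]; simp
    rw [← this]; norm_num
  have hsplit : ∑ x, A m n c x • S x = A m n c 0 • S 0 + A m n c 1 • S 1 + A m n c (-1) • S (-1)
      + ∑ x ∈ T, A m n c x • S x := by
    rw [← Finset.sum_filter_add_sum_filter_not Finset.univ (fun x => x ≠ 0 ∧ x ≠ 1 ∧ x ≠ -1),
      ← hT, add_comm]
    congr 1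
    have : (Finset.univ.filter (fun x : ZMod (m + 1) => ¬ (x ≠ 0 ∧ x ≠ 1 ∧ x ≠ -1)))
        = {0, 1, -1} := by
      ext x; simp; tauto
    rw [this, Finset.sum_insert, Finset.sum_insert, Finset.sum_singleton, add_assoc]
    · simpa using n2
    · simp [n1.symm]
      exact n1
  rw [hB, hsplit, hH, hQ, hF, ← a_zero, ← a_one n hn, hA0, hA1, hA2]
  have e : a n c 0 • S 0 + a n c 1 • (S 1 + S (-1) + ∑ x ∈ T, S x) -
      (a n c 0 • S 0 + a n c 1 • S 1 + a n c 1 • S (-1) + ∑ x ∈ T, A m n c x • S x)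
      = ∑ x ∈ T, (a n c 1 - A m n c x) • S x := by
    simp only [sub_smul, Finset.sum_sub_distrib, smul_add, Finset.smul_sum]
    abel
  rw [e]
  refine Matrix.posSemidef_sum _ fun x hx => ?_
  simp only [hT, Finset.mem_filter, Finset.mem_univ, true_and] at hx
  have hle : A m n c x ≤ a n c 1 := by
    have hx' := ZMod.coe_valMinAbs x
    rw [← hx', A_eq m n hn hnm]
    · apply a_le' n hn c hpos hmono hsym
      intro h0
      rw [h0] at hx'
      exact hx.1 (by rw [← hx']; simp)
    · have := ZMod.valMinAbs_mem_Ioc x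
      rw [Set.mem_Ioc] at this
      push_cast at this
      rcases abs_cases x.valMinAbs with h | h <;> omega
  have hSx : (S x).PosSemidef := by
    refine Matrix.posSemidef_sum _ fun i _ => ?_
    refine psd_mul _ _ (hherm _) (hherm _) (hidem _) (hidem _) (hcomm _ _ ?_ ?_ ?_)
    · simpa using hx.1
    · simpa using hx.2.1
    · rw [sub_eq_add_neg]; simpa using hx.2.2
  exact hSx.smul (sub_nonneg.2 hle)
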